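/- arXiv:2007.01405 — 3 statements merged into one kernel-verified Lean document; each statement's English description precedes it below -/
import Mathlib

section
/- Let A be a C*-algebra and let I and J be closed two-sided ideals of A. Then the algebraic sum I + J = { i + j : i ∈ I, j ∈ J } is a closed subset of A (and hence is itself a closed two-sided ideal of A). -/
lemma exists_approx_left_unit {A : Type*} [CStarAlgebra A] (x : A) {η : ℝ} (hη : 0 < η) :
    ∃ b : A, ‖(x * star x) * b‖ ≤ 1 ∧ ‖x - (x * star x) * b * x‖ ^ 2 ≤ η := by
  have ha : IsSelfAdjoint (x * star x) := IsSelfAdjoint.mul_star_self x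
  set a := x * star x with hadef
  have hpos : ∀ t : ℝ, 0 < t ^ 2 + η ^ 2 := fun t => by positivity
  have hc : Continuous (fun t : ℝ => t / (t ^ 2 + η ^ 2)) :=
    Continuous.div₀ (by fun_prop) (by fun_prop) (fun t => (hpos t).ne')
  have hc2 : Continuous (fun t : ℝ => t * (t / (t ^ 2 + η ^ 2))) := by fun_prop
  have he : a * cfc (fun t : ℝ => t / (t ^ 2 + η ^ 2)) a
      = cfc (fun t : ℝ => t * (t / (t ^ 2 + η ^ 2))) a := by
    rw [cfc_mul (fun t : ℝ => t) _ a (by fun_prop) hc.continuousOn, cfc_id' ℝ a]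
  refine ⟨cfc (fun t : ℝ => t / (t ^ 2 + η ^ 2)) a, ?_, ?_⟩
  · rw [he]
    refine norm_cfc_le zero_le_one fun t _ => ?_
    rw [Real.norm_eq_abs, ← mul_div_assoc, abs_of_nonneg (by have := hpos t; have := mul_self_nonneg t; positivity),
      div_le_one (hpos t)]
    nlinarith [sq_nonneg η]
  · rw [he]
    set e := cfc (fun t : ℝ => t * (t / (t ^ 2 + η ^ 2))) a with hedef
    have hesa : IsSelfAdjoint e := cfc_predicate _ a
    have h1 : (1 : A) - e = cfc (fun t : ℝ => 1 - t * (t / (t ^ 2 + η ^ 2))) a := by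
      rw [cfc_sub (fun _ : ℝ => (1 : ℝ)) _ a (by fun_prop) hc2.continuousOn, cfc_const_one ℝ a]
    have h2 : (x - e * x) * star (x - e * x) = (1 - e) * a * (1 - e) := by
      rw [star_sub, star_mul, hesa.star_eq, hadef]; noncomm_ring
    have hc3 : Continuous (fun t : ℝ => 1 - t * (t / (t ^ 2 + η ^ 2))) := by fun_prop
    have h3 : (1 - e) * a * (1 - e) = cfc (fun t : ℝ => (1 - t * (t / (t ^ 2 + η ^ 2))) * t *
        (1 - t * (t / (t ^ 2 + η ^ 2)))) a := by
      rw [cfc_mul (fun t : ℝ => (1 - t * (t / (t ^ 2 + η ^ 2))) * t) _ a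
        (hc3.mul continuous_id).continuousOn hc3.continuousOn,
        cfc_mul _ (fun t : ℝ => t) a hc3.continuousOn (by fun_prop), cfc_id' ℝ a, h1]
    rw [sq, ← CStarRing.norm_self_mul_star, h2, h3]
    refine norm_cfc_le hη.le fun t _ => ?_
    have h4 : 1 - t * (t / (t ^ 2 + η ^ 2)) = η ^ 2 / (t ^ 2 + η ^ 2) := by
      have := (hpos t).ne'
      field_simp
      ring
    have h5 : η ^ 2 / (t ^ 2 + η ^ 2) ≤ 1 := by
      rw [div_le_one (hpos t)]; nlinarith [sq_nonneg t]
    have h6 : 0 ≤ η ^ 2 / (t ^ 2 + η ^ 2) := by have := hpos t; positivity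
    rw [h4, Real.norm_eq_abs, abs_mul, abs_mul, abs_of_nonneg h6]
    have h7 : η ^ 2 / (t ^ 2 + η ^ 2) * |t| ≤ η := by
      rw [div_mul_eq_mul_div, div_le_iff₀ (hpos t), ← sq_abs t]
      nlinarith [mul_nonneg hη.le (sq_nonneg (|t| - η)), mul_nonneg hη.le (sq_nonneg |t|),
        pow_pos hη 3]
    calc _ ≤ η * 1 := by gcongr
      _ = η := mul_one η

/-- The algebraic sum of two closed two-sided ideals of a C*-algebra is closed. -/
theorem sum_of_two_closed_ideals_isClosed
    {A : Type*} [NormedRing A] [StarRing A] [CStarRing A]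
    [NormedAlgebra ℂ A] [StarModule ℂ A] [CompleteSpace A]
    (I J : Submodule ℂ A)
    (hIclosed : IsClosed (I : Set A)) (hJclosed : IsClosed (J : Set A))
    (hIideal : ∀ a : A, ∀ x ∈ I, a * x ∈ I ∧ x * a ∈ I)
    (hJideal : ∀ a : A, ∀ x ∈ J, a * x ∈ J ∧ x * a ∈ J) :
    IsClosed {x : A | ∃ i ∈ I, ∃ j ∈ J, x = i + j} := by
  let _ : CStarAlgebra A := {}
  have : CompleteSpace I := hIclosed.completeSpace_coe
  have : CompleteSpace J := hJclosed.completeSpace_coe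
  let f : NormedAddGroupHom (I × J) A :=
    AddMonoidHom.mkNormedAddGroupHom
      (I.subtype.toAddMonoidHom.coprod J.subtype.toAddMonoidHom) 2 (by
        rintro ⟨i, j⟩
        have h1 : ‖(i : A)‖ ≤ ‖(i, j)‖ := norm_fst_le (i, j)
        have h2 : ‖(j : A)‖ ≤ ‖(i, j)‖ := norm_snd_le (i, j)
        calc ‖(i : A) + j‖ ≤ ‖(i : A)‖ + ‖(j : A)‖ := norm_add_le _ _
          _ ≤ 2 * ‖(i, j)‖ := by linarith)
  have hf : ∀ (i : I) (j : J), f (i, j) = (i : A) + j := fun i j => rfl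
  have hset : {x : A | ∃ i ∈ I, ∃ j ∈ J, x = i + j} = (f.range : Set A) := by
    ext x
    constructor
    · rintro ⟨i, hi, j, hj, rfl⟩
      exact ⟨(⟨i, hi⟩, ⟨j, hj⟩), rfl⟩
    · rintro ⟨⟨i, j⟩, rfl⟩
      exact ⟨i, i.2, j, j.2, rfl⟩
  have key : f.SurjectiveOnWith f.range 3 := by
    rintro _ ⟨⟨i, j⟩, rfl⟩
    by_cases hs : f (i, j) = 0
    · exact ⟨0, by simp [hs], by simp⟩
    have hs' : 0 < ‖f (i, j)‖ := norm_pos_iff.mpr hs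
    obtain ⟨b, hb1, hb2⟩ := exists_approx_left_unit (i : A) (pow_pos hs' 2)
    have hb3 := le_of_sq_le_sq hb2 hs'.le
    set e := (i : A) * star (i : A) * b with he
    have heI : e ∈ I := (hIideal _ _ (hIideal _ _ i.2).2).2
    have hej1 : e * j ∈ I := (hIideal _ _ heI).2
    have hej2 : e * j ∈ J := (hJideal _ _ j.2).1
    have hsum : f (i + ⟨e * j, hej1⟩, j - ⟨e * j, hej2⟩) = f (i, j) := by
      simp [hf]
    have hi : ‖(i : A) + e * j‖ ≤ 2 * ‖f (i, j)‖ := by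
      have : (i : A) + e * j = (i - e * i) + e * f (i, j) := by
        rw [hf]; noncomm_ring
      rw [this]
      have h2 : ‖e * f (i, j)‖ ≤ 1 * ‖f (i, j)‖ :=
        (norm_mul_le _ _).trans (by gcongr)
      linarith [norm_add_le ((i : A) - e * i) (e * f (i, j))]
    have hj : ‖(j : A) - e * j‖ ≤ 3 * ‖f (i, j)‖ := by
      have : (j : A) - e * j = f (i, j) - (i + e * j) := by
        rw [hf]; noncomm_ring
      rw [this]
      linarith [norm_sub_le (f (i, j)) ((i : A) + e * j)]
    refine ⟨_, hsum, ?_⟩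
    rw [Prod.norm_def]
    have hi' : ‖(i : A) + e * j‖ ≤ 3 * ‖f (i, j)‖ := by linarith
    exact max_le hi' hj
  have := controlled_closure_of_complete (by norm_num : (0:ℝ) < 3) one_pos key
  rw [hset]
  refine isClosed_of_closure_subset fun x hx => ?_
  obtain ⟨g, hg, -⟩ := this x hx
  exact ⟨g, hg⟩
end

section
/- Let A be a C*-algebra and let I and J be closed two-sided ideals of A. Then the annihilator of I ∩ J in the continuous dual A* equals the algebraic sum of the annihilators of I and of J; that is, a continuous linear functional φ : A → ℂ vanishes identically on I ∩ J if and only if there exist continuous linear functionals φ₁, φ₂ : A → ℂ with φ₁ vanishing on I, φ₂ vanishing on J, and φ = φ₁ + φ₂. -/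
lemma aux_cfc {A : Type*} [CStarAlgebra A] [PartialOrder A] [StarOrderedRing A]
    (b : A) (hb : 0 ≤ b) (ε : ℝ) (hε : 0 < ε) :
    ∃ c : A, IsSelfAdjoint (1 - b * c) ∧ ‖b * c‖ ≤ 1 ∧
      ‖(1 - b * c) * b * (1 - b * c)‖ ≤ ε := by
  have hbs : IsSelfAdjoint b := IsSelfAdjoint.of_nonneg hb
  have hsp : ∀ x ∈ spectrum ℝ b, 0 ≤ x := fun x hx => spectrum_nonneg_of_nonneg hb hx
  have hc : ContinuousOn (fun x : ℝ => (x + ε)⁻¹) (spectrum ℝ b) := by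
    apply ContinuousOn.inv₀ (by fun_prop)
    intro x hx
    have := hsp x hx
    positivity
  have h1 : b * cfc (fun x : ℝ => (x + ε)⁻¹) b = cfc (fun x : ℝ => x * (x + ε)⁻¹) b := by
    rw [cfc_mul (fun x : ℝ => x) _ b (by fun_prop) hc, cfc_id' ℝ b]
  have hc2 : ContinuousOn (fun x : ℝ => x * (x + ε)⁻¹) (spectrum ℝ b) :=
    ContinuousOn.mul (by fun_prop) hc
  have h2 : 1 - b * cfc (fun x : ℝ => (x + ε)⁻¹) b
      = cfc (fun x : ℝ => 1 - x * (x + ε)⁻¹) b := by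
    rw [cfc_sub (fun _ : ℝ => (1 : ℝ)) _ b (by fun_prop) hc2, cfc_const_one ℝ b, h1]
  have hc3 : ContinuousOn (fun x : ℝ => 1 - x * (x + ε)⁻¹) (spectrum ℝ b) :=
    ContinuousOn.sub (by fun_prop) hc2
  refine ⟨cfc (fun x : ℝ => (x + ε)⁻¹) b, ?_, ?_, ?_⟩
  · rw [h2]; exact cfc_predicate _ _
  · rw [h1]
    refine norm_cfc_le zero_le_one fun x hx => ?_
    have := hsp x hx
    rw [Real.norm_of_nonneg (by positivity), ← div_eq_mul_inv, div_le_one (by positivity)]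
    linarith
  · rw [h2]
    have h3 : cfc (fun x : ℝ => 1 - x * (x + ε)⁻¹) b * b * cfc (fun x : ℝ => 1 - x * (x + ε)⁻¹) b
        = cfc (fun x : ℝ => (1 - x * (x + ε)⁻¹) * x * (1 - x * (x + ε)⁻¹)) b := by
      rw [cfc_mul (fun x : ℝ => (1 - x * (x + ε)⁻¹) * x) _ b
        (ContinuousOn.mul hc3 (by fun_prop)) hc3,
        cfc_mul _ (fun x : ℝ => x) b hc3 (by fun_prop), cfc_id' ℝ b]
    rw [h3]
    refine norm_cfc_le hε.le fun x hx => ?_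
    have hx0 := hsp x hx
    have hp : 0 < x + ε := by positivity
    have e : (1 - x * (x + ε)⁻¹) * x * (1 - x * (x + ε)⁻¹) = ε ^ 2 * x / (x + ε) ^ 2 := by
      field_simp
      ring
    rw [e, Real.norm_of_nonneg (by positivity), div_le_iff₀ (by positivity)]
    have : 0 ≤ ε * (x ^ 2 + ε * x + ε ^ 2) := by positivity
    nlinarith

lemma aux_unit {A : Type*} [CStarAlgebra A] (I : Submodule ℂ A)
    (hI : ∀ a : A, ∀ x ∈ I, x * a ∈ I) (F : Finset I) (δ : ℝ) (hδ : 0 < δ) :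
    ∃ u ∈ I, ‖u‖ ≤ 1 ∧ ∀ a ∈ F, ‖(a : A) - u * a‖ ≤ δ := by
  letI : PartialOrder A := CStarAlgebra.spectralOrder A
  haveI : StarOrderedRing A := CStarAlgebra.spectralOrderedRing A
  set b : A := ∑ a ∈ F, (a : A) * star (a : A) with hbdef
  have hb : 0 ≤ b := Finset.sum_nonneg fun a _ => mul_star_self_nonneg _
  have hbI : b ∈ I := Submodule.sum_mem _ fun a _ => hI _ _ a.2
  obtain ⟨c, hs, hn, hle⟩ := aux_cfc b hb (δ ^ 2) (by positivity)
  refine ⟨b * c, hI _ _ hbI, hn, fun a ha => ?_⟩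
  have hab : (a : A) * star (a : A) ≤ b :=
    Finset.single_le_sum (f := fun a : I => (a : A) * star (a : A))
      (fun a _ => mul_star_self_nonneg _) ha
  have key : ‖(a : A) - b * c * a‖ * ‖(a : A) - b * c * a‖ ≤ δ ^ 2 := by
    rw [← CStarRing.norm_self_mul_star]
    have e : ((a : A) - b * c * a) * star ((a : A) - b * c * a)
        = (1 - b * c) * ((a : A) * star (a : A)) * star (1 - b * c) := by
      have : (a : A) - b * c * a = (1 - b * c) * a := by noncomm_ring
      rw [this, star_mul]
      simp only [mul_assoc]
    rw [e]
    refine le_trans (CStarAlgebra.norm_le_norm_of_nonneg_of_le ?_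
      (star_right_conjugate_le_conjugate hab (1 - b * c))) ?_
    · exact star_right_conjugate_nonneg (mul_star_self_nonneg _) _
    · rw [hs.star_eq]; exact hle
  nlinarith [norm_nonneg ((a : A) - b * c * a)]

open Filter Topology in
lemma aux_main {A : Type*} [CStarAlgebra A] (I J : Submodule ℂ A)
    (hI : ∀ a : A, ∀ x ∈ I, x * a ∈ I) (hJ : ∀ a : A, ∀ x ∈ J, a * x ∈ J)
    (φ : A →L[ℂ] ℂ) (h : ∀ x, x ∈ I → x ∈ J → φ x = 0) :
    ∃ φ₁ φ₂ : A →L[ℂ] ℂ,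
        (∀ x ∈ I, φ₁ x = 0) ∧ (∀ x ∈ J, φ₂ x = 0) ∧ φ = φ₁ + φ₂ := by
  classical
  choose u huI hu1 hu using fun p : Finset I × ℕ =>
    aux_unit I hI p.1 (1 / ((p.2 : ℝ) + 1)) Nat.one_div_pos_of_nat
  let U : Ultrafilter (Finset I × ℕ) := Ultrafilter.of atTop
  have hU : (U : Filter (Finset I × ℕ)) ≤ atTop := Ultrafilter.of_le _
  have hbd : ∀ a p, ‖φ (u p * a)‖ ≤ ‖φ‖ * ‖a‖ := fun a p => by
    refine (φ.le_opNorm _).trans ?_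
    gcongr
    refine (norm_mul_le _ _).trans ?_
    exact mul_le_of_le_one_left (norm_nonneg _) (hu1 p)
  have hlim : ∀ a, ∃ z : ℂ, ‖z‖ ≤ ‖φ‖ * ‖a‖ ∧ Tendsto (fun p => φ (u p * a)) U (𝓝 z) := by
    intro a
    have hc := isCompact_closedBall (0 : ℂ) (‖φ‖ * ‖a‖)
    obtain ⟨z, hz, hz'⟩ := hc.ultrafilter_le_nhds (U.map fun p => φ (u p * a)) (by
      simp only [le_principal_iff, Ultrafilter.coe_map, mem_map]
      exact Filter.univ_mem' fun p => by simpa using hbd a p)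
    exact ⟨z, by simpa using hz, hz'⟩
  choose g hg hgt using hlim
  let ψ₀ : A →ₗ[ℂ] ℂ :=
    { toFun := g
      map_add' := fun a b => tendsto_nhds_unique (hgt (a + b)) (by
        simpa only [mul_add, map_add] using (hgt a).add (hgt b))
      map_smul' := fun k a => tendsto_nhds_unique (hgt (k • a)) (by
        simpa only [mul_smul_comm, map_smul, RingHom.id_apply] using (hgt a).const_smul k) }
  let ψ : A →L[ℂ] ℂ := ψ₀.mkContinuous ‖φ‖ hg
  have hψ : ∀ a, ψ a = g a := fun a => rfl
  refine ⟨φ - ψ, ψ, fun x hx => ?_, fun x hx => ?_, by simp⟩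
  · rw [ContinuousLinearMap.sub_apply, hψ, sub_eq_zero]
    refine tendsto_nhds_unique ?_ (hgt x)
    refine Tendsto.mono_left ?_ hU
    have : Tendsto (fun p => u p * x) atTop (𝓝 x) := by
      rw [tendsto_iff_norm_sub_tendsto_zero]
      have h0 : Tendsto (fun p : Finset I × ℕ => 1 / ((p.2 : ℝ) + 1)) atTop (𝓝 0) := by
        rw [← prod_atTop_atTop_eq]
        exact (tendsto_one_div_add_atTop_nhds_zero_nat (𝕜 := ℝ)).comp tendsto_snd
      refine squeeze_zero' (Eventually.of_forall fun _ => norm_nonneg _) ?_ h0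
      filter_upwards [eventually_ge_atTop (({⟨x, hx⟩} : Finset I), 0)] with p hp
      rw [norm_sub_rev]
      exact hu p ⟨x, hx⟩ (hp.1 (by simp))
    exact (φ.continuous.tendsto x).comp this
  · rw [hψ]
    refine tendsto_nhds_unique (hgt x) ?_
    have : (fun p => φ (u p * x)) = fun _ => 0 := by
      funext p
      exact h _ (hI _ _ (huI p)) (hJ _ _ hx)
    rw [this]
    exact tendsto_const_nhds

/-- For closed two-sided ideals `I`, `J` of a C*-algebra, the annihilator of `I ∩ J`
in the continuous dual is the algebraic sum of the annihilators of `I` and `J`. -/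
theorem annihilator_inter_eq_sum_annihilators
    {A : Type*} [NormedRing A] [StarRing A] [CStarRing A]
    [NormedAlgebra ℂ A] [StarModule ℂ A] [CompleteSpace A]
    (I J : Submodule ℂ A)
    (hIclosed : IsClosed (I : Set A)) (hJclosed : IsClosed (J : Set A))
    (hIideal : ∀ a : A, ∀ x ∈ I, a * x ∈ I ∧ x * a ∈ I)
    (hJideal : ∀ a : A, ∀ x ∈ J, a * x ∈ J ∧ x * a ∈ J)
    (φ : A →L[ℂ] ℂ) :
    (∀ x, x ∈ I → x ∈ J → φ x = 0) ↔
      ∃ φ₁ φ₂ : A →L[ℂ] ℂ,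
        (∀ x ∈ I, φ₁ x = 0) ∧ (∀ x ∈ J, φ₂ x = 0) ∧ φ = φ₁ + φ₂ := by
  constructor
  · intro h
    letI : CStarAlgebra A := {}
    exact aux_main I J (fun a x hx => (hIideal a x hx).2) (fun a x hx => (hJideal a x hx).1) φ h
  · rintro ⟨φ₁, φ₂, h1, h2, rfl⟩ x hxI hxJ
    simp [h1 x hxI, h2 x hxJ]
end

section
/- Let A be a C*-algebra and let I and J be closed two-sided ideals of A. Then for every a ∈ A, the distance from a to I ∩ J equals the maximum of the distance from a to I and the distance from a to J: inf_{x ∈ I ∩ J} ‖a − x‖ = max( inf_{x ∈ I} ‖a − x‖ , inf_{x ∈ J} ‖a − x‖ ). Equivalently, the canonical *-homomorphism A/(I ∩ J) → A/I × A/J is isometric when the product carries the maximum norm. -/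
/-- Cut-off function: `1` on `t ≤ M²`, and `M / √t` beyond. -/
noncomputable def cutoffFn (M t : ℝ) : ℝ := M / max M (Real.sqrt t)

lemma cutoffFn_continuous {M : ℝ} (hM : 0 < M) : Continuous (cutoffFn M) := by
  unfold cutoffFn
  refine continuous_const.div (by fun_prop) fun t => ?_
  exact (lt_max_of_lt_left hM).ne'

lemma cutoffFn_eq_one {M t : ℝ} (hM : 0 < M) (ht : t ≤ M ^ 2) : cutoffFn M t = 1 := by
  unfold cutoffFn
  rw [max_eq_left (Real.sqrt_le_iff.2 ⟨hM.le, ht⟩), div_self hM.ne']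

lemma cutoffFn_bound {M t : ℝ} (hM : 0 < M) (ht : 0 ≤ t) :
    ‖cutoffFn M t * t * cutoffFn M t‖ ≤ M ^ 2 := by
  have h0 : 0 < max M (Real.sqrt t) := lt_max_of_lt_left hM
  have h1 : t ≤ (max M (Real.sqrt t)) ^ 2 := by
    calc t = (Real.sqrt t) ^ 2 := (Real.sq_sqrt ht).symm
      _ ≤ _ := by gcongr; exact le_max_right _ _
  have h2 : cutoffFn M t * t * cutoffFn M t = M ^ 2 * (t / (max M (Real.sqrt t)) ^ 2) := by
    unfold cutoffFn; field_simp
  rw [h2, Real.norm_of_nonneg (by positivity)]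
  exact mul_le_of_le_one_right (by positivity) ((div_le_one (by positivity)).2 h1)

lemma norm_mul_cutoff_le {A : Type*} [CStarAlgebra A] (a : A) {M : ℝ} (hM : 0 < M) :
    ‖a * cfc (cutoffFn M) (star a * a)‖ ≤ M := by
  have hc := cutoffFn_continuous hM
  have hs : IsSelfAdjoint (star a * a) := IsSelfAdjoint.star_mul_self a
  have hsa : star (cfc (cutoffFn M) (star a * a)) = cfc (cutoffFn M) (star a * a) :=
    (cfc_predicate (cutoffFn M) (star a * a) : IsSelfAdjoint _)
  refine le_of_sq_le_sq ?_ hM.le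
  rw [sq, ← CStarRing.norm_star_mul_self, star_mul, hsa]
  have : cfc (cutoffFn M) (star a * a) * star a * (a * cfc (cutoffFn M) (star a * a))
      = cfc (fun t => cutoffFn M t * t * cutoffFn M t) (star a * a) := by
    rw [cfc_mul (fun t => cutoffFn M t * t) (cutoffFn M) (star a * a) (by fun_prop) (by fun_prop),
      cfc_mul (cutoffFn M) (fun t => t) (star a * a) (by fun_prop) (by fun_prop),
      cfc_id' ℝ (star a * a)]
    simp only [mul_assoc]
  rw [this]
  refine norm_cfc_le (by positivity) fun t ht => cutoffFn_bound hM ?_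
  exact spectrum_star_mul_self_nonneg t ht

lemma pow_sub_pow_mem_ideal {A : Type*} [CStarAlgebra A] (I : Submodule ℂ A)
    (hI : ∀ a : A, ∀ x ∈ I, a * x ∈ I ∧ x * a ∈ I) {b s : A} (h : b - s ∈ I) (n : ℕ) :
    b ^ n - s ^ n ∈ I := by
  induction n with
  | zero => simp
  | succ n ih =>
    have : b ^ (n + 1) - s ^ (n + 1) = b ^ n * (b - s) + (b ^ n - s ^ n) * s := by
      rw [pow_succ, pow_succ]; noncomm_ring
    rw [this]
    exact I.add_mem (hI _ _ h).1 (hI _ _ ih).2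

lemma aeval_sub_mem_ideal {A : Type*} [CStarAlgebra A] (I : Submodule ℂ A)
    (hI : ∀ a : A, ∀ x ∈ I, a * x ∈ I ∧ x * a ∈ I) {b s : A} (h : b - s ∈ I)
    (p : Polynomial ℝ) :
    Polynomial.aeval b p - Polynomial.aeval s p ∈ I := by
  rw [Polynomial.aeval_eq_sum_range, Polynomial.aeval_eq_sum_range, ← Finset.sum_sub_distrib]
  refine I.sum_mem fun i _ => ?_
  rw [← smul_sub]
  exact I.smul_mem ((p.coeff i : ℝ) : ℂ) (pow_sub_pow_mem_ideal I hI h i)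

lemma cfc_sub_mem_ideal {A : Type*} [CStarAlgebra A] (I : Submodule ℂ A)
    (hcl : IsClosed (I : Set A))
    (hI : ∀ a : A, ∀ x ∈ I, a * x ∈ I ∧ x * a ∈ I) {b s : A}
    (hb : IsSelfAdjoint b) (hs : IsSelfAdjoint s) (h : b - s ∈ I)
    {f : ℝ → ℝ} (hf : Continuous f) : cfc f b - cfc f s ∈ I := by
  rcases subsingleton_or_nontrivial A with hA | hA
  · rw [Subsingleton.elim (cfc f b - cfc f s) 0]; exact I.zero_mem
  change _ ∈ (I : Set A)
  rw [← hcl.closure_eq, Metric.mem_closure_iff]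
  intro ε hε
  set R := max ‖b‖ ‖s‖
  obtain ⟨p, hp⟩ := exists_polynomial_near_of_continuousOn (-R) R f hf.continuousOn (ε / 3)
    (by positivity)
  have key : ∀ c : A, IsSelfAdjoint c → ‖c‖ ≤ R → ‖cfc f c - Polynomial.aeval c p‖ ≤ ε / 3 := by
    intro c hc hcR
    rw [← cfc_polynomial p c, ← cfc_sub f p.eval c (by fun_prop) (by fun_prop)]
    refine norm_cfc_le (by positivity) fun t ht => ?_
    have h1 : ‖t‖ ≤ R := (spectrum.norm_le_norm_of_mem ht).trans hcR
    have h2 := hp t (abs_le.1 h1)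
    rw [Real.norm_eq_abs, abs_sub_comm]
    exact h2.le
  refine ⟨_, aeval_sub_mem_ideal I hI h p, ?_⟩
  rw [dist_eq_norm]
  have e : cfc f b - cfc f s - (Polynomial.aeval b p - Polynomial.aeval s p)
    = (cfc f b - Polynomial.aeval b p) - (cfc f s - Polynomial.aeval s p) := by abel
  rw [e]
  have := norm_sub_le (cfc f b - Polynomial.aeval b p) (cfc f s - Polynomial.aeval s p)
  have := key b hb (le_max_left _ _)
  have := key s hs (le_max_right _ _)
  linarith

lemma cfc_cutoff_eq_one {A : Type*} [CStarAlgebra A] (c : A) {M : ℝ} (hM : 0 < M)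
    (hc : ‖c‖ ≤ M) : cfc (cutoffFn M) (star c * c) = 1 := by
  rcases subsingleton_or_nontrivial A with hA | hA
  · exact Subsingleton.elim _ _
  have hs : IsSelfAdjoint (star c * c) := IsSelfAdjoint.star_mul_self c
  rw [← cfc_const_one ℝ (star c * c)]
  refine cfc_congr fun t ht => cutoffFn_eq_one hM ?_
  have h1 : ‖t‖ ≤ ‖star c * c‖ := spectrum.norm_le_norm_of_mem ht
  rw [CStarRing.norm_star_mul_self] at h1
  have := le_abs_self t
  rw [Real.norm_eq_abs] at h1
  nlinarith [norm_nonneg c]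

lemma star_mem_closed_ideal {A : Type*} [CStarAlgebra A] (I : Submodule ℂ A)
    (hcl : IsClosed (I : Set A))
    (hI : ∀ a : A, ∀ x ∈ I, a * x ∈ I ∧ x * a ∈ I) {x : A} (hx : x ∈ I) : star x ∈ I := by
  change _ ∈ (I : Set A)
  rw [← hcl.closure_eq, Metric.mem_closure_iff]
  intro ε hε
  have hM : 0 < ε / 2 := by positivity
  have h1 := cfc_sub_mem_ideal I hcl hI (IsSelfAdjoint.star_mul_self x)
    (IsSelfAdjoint.star_mul_self (0 : A)) (by simpa using (hI (star x) x hx).1)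
    (cutoffFn_continuous hM)
  rw [cfc_cutoff_eq_one (0 : A) hM (by simpa using hM.le)] at h1
  have hsa : star (cfc (cutoffFn (ε / 2)) (star x * x)) = cfc (cutoffFn (ε / 2)) (star x * x) :=
    (cfc_predicate (cutoffFn (ε / 2)) (star x * x) : IsSelfAdjoint _)
  refine ⟨_, I.neg_mem (hI (star x) _ h1).2, ?_⟩
  have h2 := norm_mul_cutoff_le x hM
  rw [← norm_star, star_mul, hsa] at h2
  rw [dist_eq_norm, sub_neg_eq_add, sub_mul, one_mul, add_sub_cancel]
  linarith

lemma cutoff_sub_one_mem {A : Type*} [CStarAlgebra A] (I : Submodule ℂ A)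
    (hcl : IsClosed (I : Set A))
    (hI : ∀ a : A, ∀ x ∈ I, a * x ∈ I ∧ x * a ∈ I) (a : A) {M : ℝ} (hM : 0 < M)
    (hd : Metric.infDist a (I : Set A) < M) :
    cfc (cutoffFn M) (star a * a) - 1 ∈ I := by
  obtain ⟨x, hx, hax⟩ := (Metric.infDist_lt_iff ⟨0, I.zero_mem⟩).1 hd
  rw [dist_eq_norm] at hax
  rw [← cfc_cutoff_eq_one (a - x) hM hax.le]
  refine cfc_sub_mem_ideal I hcl hI (IsSelfAdjoint.star_mul_self a)
    (IsSelfAdjoint.star_mul_self _) ?_ (cutoffFn_continuous hM)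
  have : star a * a - star (a - x) * (a - x) = star a * x + star x * (a - x) := by
    rw [star_sub]; noncomm_ring
  rw [this]
  exact I.add_mem (hI _ _ hx).1 (hI _ _ (star_mem_closed_ideal I hcl hI hx)).2

lemma infDist_inter_aux {A : Type*} [CStarAlgebra A]
    (I J : Submodule ℂ A)
    (hIclosed : IsClosed (I : Set A)) (hJclosed : IsClosed (J : Set A))
    (hIideal : ∀ a : A, ∀ x ∈ I, a * x ∈ I ∧ x * a ∈ I)
    (hJideal : ∀ a : A, ∀ x ∈ J, a * x ∈ J ∧ x * a ∈ J)
    (a : A) :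
    Metric.infDist a ((I : Set A) ∩ (J : Set A)) =
      max (Metric.infDist a (I : Set A)) (Metric.infDist a (J : Set A)) := by
  have hne : ((I : Set A) ∩ (J : Set A)).Nonempty := ⟨0, I.zero_mem, J.zero_mem⟩
  apply le_antisymm
  · refine le_of_forall_gt_imp_ge_of_dense fun M hlt => ?_
    have hI := (le_max_left _ _).trans_lt hlt
    have hJ := (le_max_right _ _).trans_lt hlt
    have hM : 0 < M := Metric.infDist_nonneg.trans_lt hI
    have h1 := cutoff_sub_one_mem I hIclosed hIideal a hM hI
    have h2 := cutoff_sub_one_mem J hJclosed hJideal a hM hJ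
    have hz : -(a * (cfc (cutoffFn M) (star a * a) - 1)) ∈ (I : Set A) ∩ (J : Set A) :=
      ⟨I.neg_mem (hIideal a _ h1).1, J.neg_mem (hJideal a _ h2).1⟩
    refine (Metric.infDist_le_dist_of_mem hz).trans ?_
    rw [dist_eq_norm, sub_neg_eq_add, mul_sub, mul_one, add_sub_cancel]
    exact norm_mul_cutoff_le a hM
  · exact max_le (Metric.infDist_le_infDist_of_subset Set.inter_subset_left hne)
      (Metric.infDist_le_infDist_of_subset Set.inter_subset_right hne)


/-- For closed two-sided ideals `I`, `J` of a C*-algebra, the distance of any element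
to `I ∩ J` is the maximum of its distances to `I` and to `J`; equivalently, the
canonical map `A/(I ∩ J) → A/I × A/J` is isometric for the max norm. -/
theorem infDist_inter_eq_max_infDist
    {A : Type*} [NormedRing A] [StarRing A] [CStarRing A]
    [NormedAlgebra ℂ A] [StarModule ℂ A] [CompleteSpace A]
    (I J : Submodule ℂ A)
    (hIclosed : IsClosed (I : Set A)) (hJclosed : IsClosed (J : Set A))
    (hIideal : ∀ a : A, ∀ x ∈ I, a * x ∈ I ∧ x * a ∈ I)
    (hJideal : ∀ a : A, ∀ x ∈ J, a * x ∈ J ∧ x * a ∈ J)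
    (a : A) :
    Metric.infDist a ((I : Set A) ∩ (J : Set A)) =
      max (Metric.infDist a (I : Set A)) (Metric.infDist a (J : Set A)) := by
  let _ : CStarAlgebra A := {}
  exact infDist_inter_aux I J hIclosed hJclosed hIideal hJideal a
end
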